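/- Surjective relative categoricity theorem: let E assign to every type M an equivalence relation E_M on Set M that is isomorphism invariant, i.e., for every bijection e : M ≃ N and all X, Y : Set M, E_M X Y ↔ E_N (e '' X) (e '' Y). Then the following are equivalent: (i) for every type M and all surjective ∂₁, ∂₂ : Set M → M each satisfying A_E on M (Set.range ∂₁ = Set.range ∂₂ = Set.univ), there is a bijection Γ : M ≃ M such that for every X : Set M, Γ (∂₁ X) = ∂₂ (Γ '' X); (ii) A_E is bicardinality coarsening on abstracts: for every type M, every surjective ∂ satisfying A_E on M, and all X, Y : Set M, if X ⊟ Y then E_M X Y. -/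

import Mathlib

/-- Bicardinal equivalence: `X ⊟ Y` iff `|X| = |Y|` and `|Xᶜ| = |Yᶜ|`. -/
def Bicard {M : Type*} (X Y : Set M) : Prop :=
  Cardinal.mk X = Cardinal.mk Y ∧ Cardinal.mk (Xᶜ : Set M) = Cardinal.mk (Yᶜ : Set M)

/-- `a ⊴ b`: there is `n : ℕ` with `a ≤ n * b`. -/
def Trile (a b : Cardinal) : Prop := ∃ n : ℕ, a ≤ n * b

/-- `a ◁ b`: `a ⊴ b` and not `b ⊴ a`. -/
def Trilt (a b : Cardinal) : Prop := Trile a b ∧ ¬ Trile b a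

/-- Permutation invariance of a relation on concepts. -/
def PermInv {M : Type*} (E : Set M → Set M → Prop) : Prop :=
  ∀ (π : M ≃ M) (X Y : Set M), E X Y ↔ E (π '' X) (π '' Y)

/-- The bicardinal slice `E(⊟)_X` is trivial. -/
def TrivialSlice {M : Type*} (E : Set M → Set M → Prop) (X : Set M) : Prop :=
  ∀ Y Z : Set M, Bicard Y X → Bicard Z X → E Y Z

/-- The bicardinal slice `E(⊟)_X` is separative (refines a separation). -/
def Separative {M : Type*} (E : Set M → Set M → Prop) (X : Set M) : Prop :=
  ∀ Y Z : Set M, Bicard Y X → Bicard Z X → E Y Z →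
    Trilt (Cardinal.mk (symmDiff Y Z : Set M)) (Cardinal.mk X)

/-- The bicardinal slice `E(⊟)_X` is complementative (refines a complementation). -/
def Complementative {M : Type*} (E : Set M → Set M → Prop) (X : Set M) : Prop :=
  ∀ Y Z : Set M, Bicard Y X → Bicard Z X → E Y Z →
    Trilt (Cardinal.mk (symmDiff Y Z : Set M)) (Cardinal.mk X) ∨
      Trilt (Cardinal.mk ((symmDiff Y Z)ᶜ : Set M)) (Cardinal.mk X)

/-- Properly separative: separative and not trivial. -/
def ProperlySeparative {M : Type*} (E : Set M → Set M → Prop) (X : Set M) : Prop :=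
  Separative E X ∧ ¬ TrivialSlice E X

/-- Properly complementative: complementative, not separative, and not trivial. -/
def ProperlyComplementative {M : Type*} (E : Set M → Set M → Prop) (X : Set M) : Prop :=
  Complementative E X ∧ ¬ Separative E X ∧ ¬ TrivialSlice E X

universe u

open Cardinal in
theorem exists_perm_of_mk_fiber_eq {M : Type u} {ι : Type*} (f g : M → ι)
    (h : ∀ i, #{x // f x = i} = #{x // g x = i}) : ∃ π : M ≃ M, ∀ x, g (π x) = f x := by
  have e i := (Cardinal.eq.1 (h i)).some
  refine ⟨(Equiv.sigmaFiberEquiv f).symm.trans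
    ((Equiv.sigmaCongrRight e).trans (Equiv.sigmaFiberEquiv g)), fun x => ?_⟩
  exact (e (f x) ⟨x, rfl⟩).2

open Cardinal in
theorem exists_perm_image_eq_of_bicard {M : Type u} {X Y : Set M} (h : Bicard X Y) :
    ∃ π : M ≃ M, π '' X = Y := by
  obtain ⟨π, hπ⟩ := exists_perm_of_mk_fiber_eq (· ∈ X) (· ∈ Y) (fun p => by
    by_cases hp : p
    · simpa [hp] using h.1
    · simp only [hp, eq_iff_iff, iff_false]
      exact h.2)
  refine ⟨π, ?_⟩
  ext y
  obtain ⟨x, rfl⟩ := π.surjective y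
  simp [← hπ x]

open Cardinal in
/-- Two pairs of sets whose four Venn cells have the same cardinalities are conjugate under a
permutation. -/
theorem exists_perm_image_eq_image_eq {M : Type u} {U U' V V' : Set M}
    (h₁ : #(U ∩ U' : Set M) = #(V ∩ V' : Set M)) (h₂ : #(U \ U' : Set M) = #(V \ V' : Set M))
    (h₃ : #(U' \ U : Set M) = #(V' \ V : Set M))
    (h₄ : #((U ∪ U')ᶜ : Set M) = #((V ∪ V')ᶜ : Set M)) :
    ∃ π : M ≃ M, π '' U = V ∧ π '' U' = V' := by
  have hcell (A A' : Set M) (p q : Prop) :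
      #{x // ((x ∈ A, x ∈ A') : Prop × Prop) = (p, q)} =
        #({x | (x ∈ A ↔ p) ∧ (x ∈ A' ↔ q)} : Set M) := by
    simp only [Prod.mk.injEq, eq_iff_iff]
    rfl
  obtain ⟨π, hπ⟩ := exists_perm_of_mk_fiber_eq (fun x => ((x ∈ U, x ∈ U') : Prop × Prop))
    (fun x => ((x ∈ V, x ∈ V') : Prop × Prop)) (by
      rintro ⟨p, q⟩
      rw [hcell, hcell]
      by_cases hp : p <;> by_cases hq : q
      · simpa [hp, hq] using h₁
      · simpa [hp, hq, Set.sdiff_eq, Set.inter_def] using h₂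
      · simpa [hp, hq, Set.sdiff_eq, Set.inter_def, and_comm] using h₃
      · simpa [hp, hq, ← Set.compl_ofPred, Set.inter_def, Set.compl_def] using h₄)
  refine ⟨π, ?_, ?_⟩ <;> ext y <;> obtain ⟨x, rfl⟩ := π.surjective y
  · simpa using iff_of_eq (congrArg Prod.fst (hπ x)).symm
  · simpa using iff_of_eq (congrArg Prod.snd (hπ x)).symm

open Cardinal in
/-- Splitting off a subset of prescribed size from an infinite set without shrinking the rest. -/
theorem exists_subset_mk_eq_mk_diff_eq {M : Type u} {A : Set M} (hA : ℵ₀ ≤ #A) {c : Cardinal.{u}}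
    (hc : c ≤ #A) : ∃ F ⊆ A, #F = c ∧ #(A \ F : Set M) = #A := by
  obtain ⟨e⟩ : Nonempty (A ⊕ A ≃ A) := by
    rw [← Cardinal.eq, ← add_def]
    exact add_eq_self hA
  have hl : #(Set.range fun a : A => (e (.inl a) : M)) = #A :=
    mk_range_eq _ (Subtype.val_injective.comp (e.injective.comp Sum.inl_injective))
  have hr : #(Set.range fun a : A => (e (.inr a) : M)) = #A :=
    mk_range_eq _ (Subtype.val_injective.comp (e.injective.comp Sum.inr_injective))
  rw [← hl] at hc
  obtain ⟨F, hF, hFc⟩ := le_mk_iff_exists_subset.1 hc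
  refine ⟨F, ?_, hFc, le_antisymm (mk_le_mk_of_subset Set.sdiff_subset) ?_⟩
  · intro x hx
    obtain ⟨a, rfl⟩ := hF hx
    exact (e _).2
  · rw [← hr]
    refine mk_le_mk_of_subset ?_
    rintro _ ⟨a, rfl⟩
    refine ⟨(e _).2, fun h => ?_⟩
    obtain ⟨b, hb⟩ := hF h
    simpa using e.injective (Subtype.val_injective hb)

open Cardinal in
theorem mk_eq_or_mk_eq_of_mk_union {M : Type u} {A B : Set M} {c : Cardinal.{u}} (hc : ℵ₀ ≤ c)
    (h : #(A ∪ B : Set M) = c) : #A = c ∨ #B = c := by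
  by_contra! hne
  have hA := (mk_le_mk_of_subset (Set.subset_union_left (s := A) (t := B))).trans h.le
  have hB := (mk_le_mk_of_subset (Set.subset_union_right (s := A) (t := B))).trans h.le
  exact absurd (mk_union_le A B)
    (not_le.2 (h ▸ add_lt_of_lt hc (lt_of_le_of_ne hA hne.1) (lt_of_le_of_ne hB hne.2)))

open Cardinal in
/-- If one pair in general position (three cells of size `l`, the outer one of size `k`) is
identified by an invariant map, then all sets of size `l` with complement of size `k` are. -/
theorem map_eq_of_map_eq_of_general_position {M : Type u} {β : Type*} {d : Set M → β}
    (hd : ∀ (π : M ≃ M) (X Y : Set M), d X = d Y → d (π '' X) = d (π '' Y))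
    {l k : Cardinal.{u}} (hl : ℵ₀ ≤ l) (hlk : l ≤ k) {U U' : Set M} (h : d U = d U')
    (h₁ : #(U ∩ U' : Set M) = l) (h₂ : #(U \ U' : Set M) = l) (h₃ : #(U' \ U : Set M) = l)
    (h₄ : #((U ∪ U')ᶜ : Set M) = k) {V W : Set M} (hV : #V = l) (hV' : #(Vᶜ : Set M) = k)
    (hW : #W = l) (hW' : #(Wᶜ : Set M) = k) : d V = d W := by
  have half (A : Set M) (c : Cardinal.{u}) (hc : ℵ₀ ≤ c) :
      ∃ H ⊆ A, #A = c → #H = c ∧ #(A \ H : Set M) = c := by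
    by_cases hA : #A = c
    · obtain ⟨H, hH, h1, h2⟩ := exists_subset_mk_eq_mk_diff_eq (hA ▸ hc) le_rfl
      exact ⟨H, hH, fun _ => ⟨h1.trans hA, h2.trans hA⟩⟩
    · exact ⟨∅, Set.empty_subset _, fun h => absurd h hA⟩
  have hk : ℵ₀ ≤ k := hl.trans hlk
  obtain ⟨H₁, hH₁, hc₁⟩ := half (V ∩ W) l hl
  obtain ⟨H₂, hH₂, hc₂⟩ := half (V \ W) l hl
  obtain ⟨H₃, hH₃, hc₃⟩ := half (W \ V) l hl
  obtain ⟨F, hF, hFl, hFk⟩ : ∃ F ⊆ (V ∪ W)ᶜ, #F ≤ l ∧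
      (#((V ∪ W)ᶜ : Set M) = k → #F = l ∧ #((V ∪ W)ᶜ \ F : Set M) = k) := by
    by_cases hN : #((V ∪ W)ᶜ : Set M) = k
    · obtain ⟨F, hF, h1, h2⟩ := exists_subset_mk_eq_mk_diff_eq (hN ▸ hk) (hN ▸ hlk)
      exact ⟨F, hF, h1.le, fun _ => ⟨h1, h2.trans hN⟩⟩
    · exact ⟨∅, Set.empty_subset _, by simp, fun h => absurd h hN⟩
  have key (V W : Set M) (hV : #V = l) (hV' : #(Vᶜ : Set M) = k) (hW : #W = l)
      (H₁ H₂ H₃ : Set M) (hH₁ : H₁ ⊆ V ∩ W)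
      (hc₁ : #(V ∩ W : Set M) = l → #H₁ = l ∧ #((V ∩ W) \ H₁ : Set M) = l) (hH₂ : H₂ ⊆ V \ W)
      (hc₂ : #(V \ W : Set M) = l → #H₂ = l ∧ #((V \ W) \ H₂ : Set M) = l) (hH₃ : H₃ ⊆ W \ V)
      (hc₃ : #(W \ V : Set M) = l → #H₃ = l ∧ #((W \ V) \ H₃ : Set M) = l)
      (hF : F ⊆ (V ∪ W)ᶜ)
      (hFk : #((V ∪ W)ᶜ : Set M) = k → #F = l ∧ #((V ∪ W)ᶜ \ F : Set M) = k) :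
      d V = d (H₁ ∪ H₂ ∪ H₃ ∪ F) := by
    have bound {A B : Set M} {c : Cardinal.{u}} (hAB : A ⊆ B) (hB : #B ≤ c) : #A ≤ c :=
      (mk_le_mk_of_subset hAB).trans hB
    have hVc : #(V ∩ W : Set M) = l ∨ #(V \ W : Set M) = l :=
      mk_eq_or_mk_eq_of_mk_union hl (by rwa [Set.inter_union_sdiff])
    have hVc' : #(W \ V : Set M) = k ∨ #((V ∪ W)ᶜ : Set M) = k := by
      refine mk_eq_or_mk_eq_of_mk_union hk ?_
      rw [← hV']; congr 2; clear * -; grind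
    have hkl (hk' : #(W \ V : Set M) = k) : k = l :=
      le_antisymm (hk' ▸ bound Set.sdiff_subset hW.le) hlk
    set T := H₁ ∪ H₂ ∪ H₃ ∪ F with hT
    have c₁ : #(V ∩ T : Set M) = l := by
      refine le_antisymm (bound Set.inter_subset_left hV.le) ?_
      rcases hVc with h | h
      · exact (hc₁ h).1 ▸
          mk_le_mk_of_subset (by clear * - hT hH₁ hH₂ hH₃ hF; grind)
      · exact (hc₂ h).1 ▸
          mk_le_mk_of_subset (by clear * - hT hH₁ hH₂ hH₃ hF; grind)
    have c₂ : #(V \ T : Set M) = l := by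
      refine le_antisymm (bound Set.sdiff_subset hV.le) ?_
      rcases hVc with h | h
      · exact (hc₁ h).2 ▸
          mk_le_mk_of_subset (by clear * - hT hH₁ hH₂ hH₃ hF; grind)
      · exact (hc₂ h).2 ▸
          mk_le_mk_of_subset (by clear * - hT hH₁ hH₂ hH₃ hF; grind)
    have c₃ : #(T \ V : Set M) = l := by
      refine le_antisymm ((bound (show T \ V ⊆ W ∪ F by clear * - hT hH₁ hH₂ hH₃; grind)
        (mk_union_le _ _)).trans
        (add_le_of_le hl hW.le hFl)) ?_
      rcases hVc' with h | h
      · exact (hc₃ (h.trans (hkl h))).1 ▸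
          mk_le_mk_of_subset (by clear * - hT hH₁ hH₂ hH₃ hF; grind)
      · exact (hFk h).1 ▸
          mk_le_mk_of_subset (by clear * - hT hH₁ hH₂ hH₃ hF; grind)
    have c₄ : #((V ∪ T)ᶜ : Set M) = k := by
      refine le_antisymm (bound (by clear * -; grind) hV'.le) ?_
      rcases hVc' with h | h
      · rw [hkl h]
        exact (hc₃ (h.trans (hkl h))).2 ▸
          mk_le_mk_of_subset (by clear * - hT hH₁ hH₂ hH₃ hF; grind)
      · exact (hFk h).2 ▸
          mk_le_mk_of_subset (by clear * - hT hH₁ hH₂ hH₃ hF; grind)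
    obtain ⟨π, hπ, hπ'⟩ := exists_perm_image_eq_image_eq (h₁.trans c₁.symm) (h₂.trans c₂.symm)
      (h₃.trans c₃.symm) (h₄.trans c₄.symm)
    exact hπ ▸ hπ' ▸ hd π _ _ h
  rw [key V W hV hV' hW H₁ H₂ H₃ hH₁ hc₁ hH₂ hc₂ hH₃ hc₃ hF hFk,
    key W V hW hW' hV H₁ H₃ H₂ (Set.inter_comm V W ▸ hH₁) (by rwa [Set.inter_comm W V]) hH₃ hc₃
      hH₂ hc₂ (by rwa [Set.union_comm]) (by rwa [Set.union_comm]),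
    Set.union_right_comm H₁ H₃ H₂]

open Cardinal in
/-- Separativity: if an invariant map is not constant on the sets of size `l` with complement of
size `k`, then identified sets of this kind differ in less than `l` points. -/
theorem mk_diff_lt_of_map_eq {M : Type u} {β : Type*} {d : Set M → β}
    (hd : ∀ (π : M ≃ M) (X Y : Set M), d X = d Y → d (π '' X) = d (π '' Y))
    {l k : Cardinal.{u}} (hl : ℵ₀ ≤ l) (hlk : l ≤ k) {V W : Set M} (hV : #V = l)
    (hV' : #(Vᶜ : Set M) = k) (hW : #W = l) (hW' : #(Wᶜ : Set M) = k) (hVW : d V ≠ d W)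
    {Y Z : Set M} (hY : #Y = l) (hY' : #(Yᶜ : Set M) = k) (h : d Y = d Z)
    (hYZ : #((Y ∪ Z)ᶜ : Set M) = k) :
    #(Y \ Z : Set M) < l := by
  refine lt_of_le_of_ne (hY ▸ mk_le_mk_of_subset Set.sdiff_subset) fun hdiff => hVW ?_
  have hk : ℵ₀ ≤ k := hl.trans hlk
  obtain ⟨P, hP, hPl, hPl'⟩ := exists_subset_mk_eq_mk_diff_eq (hdiff ▸ hl) hdiff.ge
  obtain ⟨Q, hQ, hQl, hQk⟩ := exists_subset_mk_eq_mk_diff_eq (hYZ ▸ hk) (hYZ ▸ hlk)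
  rw [hdiff] at hPl'
  rw [hYZ] at hQk
  set Y' := (Y \ P) ∪ Q with hYPQ
  have hY'l : #Y' ≤ l :=
    (mk_union_le _ _).trans
      (add_le_of_le hl (hY ▸ mk_le_mk_of_subset Set.sdiff_subset) hQl.le)
  have e₁ : #(Y' \ Z : Set M) = l :=
    le_antisymm ((mk_le_mk_of_subset Set.sdiff_subset).trans hY'l)
      (hQl ▸ mk_le_mk_of_subset (by clear * - hYPQ hP hQ; grind))
  have e₂ : #((Y' ∪ Z)ᶜ : Set M) = k := by
    refine le_antisymm ?_ (hQk ▸ mk_le_mk_of_subset (by clear * - hYPQ hP hQ; grind))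
    refine (mk_le_mk_of_subset (show (Y' ∪ Z)ᶜ ⊆ (Y ∪ Z)ᶜ ∪ P by clear * - hYPQ hP hQ; grind)).trans
      ((mk_union_le _ _).trans (add_le_of_le hk hYZ.le (hPl.le.trans hlk)))
  obtain ⟨π, hπ, hπ'⟩ := exists_perm_image_eq_image_eq (U := Y) (U' := Z) (V := Y') (V' := Z)
    (by congr 2; clear * - hYPQ hP hQ; grind) (hdiff.trans e₁.symm)
    (by congr 2; clear * - hYPQ hP hQ; grind) (hYZ.trans e₂.symm)
  have hYY' : d Y = d Y' := by
    have := hd π _ _ h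
    rw [hπ, hπ'] at this
    exact h.trans this.symm
  refine map_eq_of_map_eq_of_general_position hd hl hlk hYY' ?_ ?_ ?_ ?_ hV hV' hW hW'
  · exact le_antisymm (hY ▸ mk_le_mk_of_subset Set.inter_subset_left)
      (hPl' ▸ mk_le_mk_of_subset (by clear * - hYPQ hP hQ; grind))
  · rw [← hPl]; congr 2; clear * - hYPQ hP hQ; grind
  · rw [← hQl]; congr 2; clear * - hYPQ hP hQ; grind
  · refine le_antisymm ?_ (hQk ▸ mk_le_mk_of_subset (by clear * - hYPQ hP hQ; grind))
    exact hY' ▸ mk_le_mk_of_subset (Set.compl_subset_compl.2 Set.subset_union_left)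

open Cardinal in
/-- On the slice of sets of full cardinality with complement of full cardinality, an invariant
map into the underlying type is constant. -/
theorem map_eq_of_mk_eq_mk_compl {M : Type u} {d : Set M → M}
    (hd : ∀ (π : M ≃ M) (X Y : Set M), d X = d Y → d (π '' X) = d (π '' Y))
    {l : Cardinal.{u}} (hl : ℵ₀ ≤ l) {V W : Set M} (hV : #V = l) (hV' : #(Vᶜ : Set M) = l)
    (hW : #W = l) (hW' : #(Wᶜ : Set M) = l) : d V = d W := by
  by_contra hVW
  have hM : #M = l := by rw [← mk_sum_compl V, hV, hV', add_eq_self hl]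
  have hM' : ℵ₀ ≤ #M := hM ▸ hl
  obtain ⟨e⟩ : Nonempty ((M ⊕ Bool) × M ≃ M) := by
    rw [← Cardinal.eq]
    simp only [mk_prod, mk_sum, lift_id, lift_uzero, mk_bool, lift_ofNat]
    rw [add_eq_left hM' (ofNat_lt_aleph0.le.trans hM'), mul_eq_self hM']
  have row_card (i : M ⊕ Bool) : #(Set.range fun m => e (i, m)) = l :=
    (mk_range_eq _ (e.injective.comp (Prod.mk_right_injective i))).trans hM
  have full {A : Set M} (i : M ⊕ Bool) (h : Set.range (fun m => e (i, m)) ⊆ A) : #A = l :=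
    le_antisymm (hM ▸ mk_set_le A) (row_card i ▸ mk_le_mk_of_subset h)
  let Y (A : Set M) : Set M := e '' {p | p.1 ∈ Sum.inl '' A ∪ {Sum.inr true}}
  have hYl (A : Set M) : #(Y A) = l := full (.inr true) (by
    rintro _ ⟨m, rfl⟩; simp [Y])
  have hsep (A B : Set M) (h : d (Y A) = d (Y B)) : A ⊆ B := by
    intro i hi
    by_contra hiB
    refine (mk_diff_lt_of_map_eq hd hl le_rfl hV hV' hW hW' hVW (hYl A) ?_ h ?_).ne ?_
    · exact full (.inr false) (by rintro _ ⟨m, rfl⟩; simp [Y])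
    · exact full (.inr false) (by rintro _ ⟨m, rfl⟩; simp [Y])
    · exact full (.inl i) (by rintro _ ⟨m, rfl⟩; simp [Y, hi, hiB])
  exact Function.cantor_injective (fun A => d (Y A))
    fun A B h => (hsep A B h).antisymm (hsep B A h.symm)

open Cardinal in
/-- There is a well-order of size `l⁺` in which every set of size at most `l` is bounded. -/
theorem exists_wellOrder_bounding {l : Cardinal.{u}} (hl : ℵ₀ ≤ l) :
    ∃ (K : Type u) (_ : LinearOrder K) (_ : WellFoundedLT K), #K = Order.succ l ∧
      ∀ A : Set K, #A ≤ l → ∃ k, ∀ a ∈ A, a < k := by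
  refine ⟨(Order.succ l).ord.ToType, inferInstance, inferInstance, mk_ord_toType _, fun A hA => ?_⟩
  by_contra! h
  have hA' : IsCofinal A := h
  have := Order.cof_le hA'
  rw [Ordinal.cof_toType, (isRegular_succ hl).cof_ord] at this
  exact absurd hA (not_le.2 (Order.succ_le_iff.1 this))

/-- A set of size `l` all of whose points are values of `d` at subsets of it of size `l`. -/
def SelfCovering {M : Type u} (l : Cardinal.{u}) (d : Set M → M) (X : Set M) : Prop :=
  Cardinal.mk X = l ∧ ∀ x ∈ X, ∃ Y ⊆ X, Cardinal.mk Y = l ∧ d Y = x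

theorem SelfCovering.image {M : Type u} {l : Cardinal.{u}} {d₁ d₂ : Set M → M} {X : Set M}
    (hX : SelfCovering l d₁ X) {Γ : M ≃ M} (hΓ : ∀ X, Γ (d₁ X) = d₂ (Γ '' X)) :
    SelfCovering l d₂ (Γ '' X) := by
  refine ⟨(Cardinal.mk_image_eq Γ.injective).trans hX.1, ?_⟩
  rintro _ ⟨x, hx, rfl⟩
  obtain ⟨Y, hYX, hY, rfl⟩ := hX.2 x hx
  exact ⟨Γ '' Y, Set.image_mono hYX, (Cardinal.mk_image_eq Γ.injective).trans hY, (hΓ Y).symm⟩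

open Cardinal in
/-- A separative map can be permuted so as to have two disjoint self-covering sets. -/
theorem exists_perm_disjoint_selfCovering {M : Type u} {d : Set M → M} {l : Cardinal.{u}}
    (hl : ℵ₀ ≤ l) (hlM : l < #M)
    (hsep : ∀ Y Z : Set M, #Y = l → #Z = l → d Y = d Z → #(Y \ Z : Set M) < l) :
    ∃ σ : M ≃ M, ∃ X X' : Set M, Disjoint X X' ∧
      SelfCovering l (fun Y => σ (d Y)) X ∧ SelfCovering l (fun Y => σ (d Y)) X' := by
  induction l using Cardinal.inductionOn with | _ L
  obtain ⟨J⟩ : Nonempty (L × L ≃ L) := by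
    rw [← Cardinal.eq]; simpa using mul_eq_self hl
  have hbig : #(Bool × L × L) = #L := by
    simp only [mk_prod, lift_id, lift_uzero, mk_bool, lift_ofNat]
    rw [mul_eq_self hl, mul_eq_right hl (ofNat_lt_aleph0.le.trans hl) two_ne_zero]
  obtain ⟨e⟩ : Nonempty (Bool × L × L ↪ M) := by
    rw [← Cardinal.le_def, hbig]; exact hlM.le
  let y (p : Bool × L × L) : Set M := Set.range fun t => e (p.1, J p.2, t)
  have hyl (p) : #(y p) = #L := mk_range_eq _ fun t t' h => by simpa using e.injective h
  have hdy : Function.Injective fun p => d (y p) := by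
    intro p q h
    by_contra hpq
    refine (hsep _ _ (hyl p) (hyl q) h).ne ?_
    rw [Disjoint.sdiff_eq_left, hyl]
    rw [Set.disjoint_left]
    rintro _ ⟨t, rfl⟩ ⟨t', ht⟩
    have := e.injective ht
    simp only [Prod.mk.injEq, J.apply_eq_iff_eq] at this
    exact hpq (Prod.ext this.1.symm this.2.1.symm)
  obtain ⟨g, hg⟩ := extend_function_of_lt (s := Set.range e)
    ((Equiv.ofInjective e e.injective).symm.toEmbedding.trans ⟨_, hdy⟩)
    (by rw [mk_range_eq _ e.injective, hbig]; exact hlM) ⟨Equiv.refl M⟩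
  have hg' (p) : g (e p) = d (y p) := by
    simpa using hg ⟨e p, p, rfl⟩
  have hcov (b : Bool) : SelfCovering #L (fun Y => g.symm (d Y)) (Set.range fun p => e (b, p)) := by
    refine ⟨?_, ?_⟩
    · rw [mk_range_eq _ fun p q h => by simpa using e.injective h]
      simpa using mul_eq_self hl
    · rintro _ ⟨p, rfl⟩
      refine ⟨y (b, p), ?_, hyl _, by simp [← hg']⟩
      rintro _ ⟨t, rfl⟩
      exact ⟨_, rfl⟩
  refine ⟨g.symm, _, _, ?_, hcov true, hcov false⟩
  rw [Set.disjoint_left]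
  rintro _ ⟨p, rfl⟩ ⟨q, hq⟩
  simpa using e.injective hq

open Cardinal in
/-- A separative map can be permuted so that any two self-covering sets meet: each of them
contains almost all of a fixed set of size `l`. -/
theorem exists_perm_not_disjoint_selfCovering {M : Type u} {d : Set M → M} {l : Cardinal.{u}}
    (hl : ℵ₀ ≤ l) (hlM : l < #M)
    (hsep : ∀ Y Z : Set M, #Y = l → #Z = l → d Y = d Z → #(Y \ Z : Set M) < l) :
    ∃ σ : M ≃ M, ∀ X X' : Set M, SelfCovering l (fun Y => σ (d Y)) X →
      SelfCovering l (fun Y => σ (d Y)) X' → ¬ Disjoint X X' := by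
  induction l using Cardinal.inductionOn with | _ L
  have hM := hl.trans hlM.le
  have hinter (C Y Z : Set M) (hC : #C = #L) (hCY : C ⊆ Y) (hY : #Y = #L) (hZ : #Z = #L)
      (h : d Y = d Z) : #L ≤ #(Z ∩ C : Set M) := by
    rcases mk_eq_or_mk_eq_of_mk_union (A := C \ Z) (B := Z ∩ C) hl
      (by rw [← hC]; congr 2; clear * -; grind) with h' | h'
    · exact absurd (mk_le_mk_of_subset (Set.sdiff_subset_sdiff_left hCY))
        (not_le.2 (h'.symm ▸ hsep Y Z hY hZ h))
    · exact h'.ge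
  obtain ⟨K, _, _, hK, hbound⟩ := exists_wellOrder_bounding hl
  have hKM : #K ≤ #M := hK ▸ Order.succ_le_of_lt hlM
  have hK0 : #K ≠ 0 := hK ▸ (Order.bot_lt_succ #L).ne'
  obtain ⟨k₀⟩ := mk_ne_zero_iff.1 hK0
  obtain ⟨e⟩ : Nonempty (L ⊕ K × M ≃ M) := by
    rw [← Cardinal.eq]
    simp only [mk_prod, mk_sum, lift_id]
    rw [mul_eq_right hM hKM hK0, add_eq_right hM hlM.le]
  obtain ⟨w⟩ : Nonempty (M × L ↪ M) := by
    rw [← Cardinal.le_def]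
    simpa using mul_le_of_le hM le_rfl hlM.le
  let B : Set M := Set.range fun t => e (.inl t)
  have hB : #B = #L := mk_range_eq _ (e.injective.comp Sum.inl_injective)
  let row (x : M) : Set M := Set.range fun t => e (.inr (k₀, w (x, t)))
  have hrow (x) : #(row x) = #L := mk_range_eq _ fun t t' h => by simpa using h
  have hBrow (x) : #(B ∪ row x : Set M) = #L :=
    le_antisymm ((mk_union_le _ _).trans (add_le_of_le hl hB.le (hrow x).le))
      (hB ▸ mk_le_mk_of_subset Set.subset_union_left)
  have hι : Function.Injective fun x => d (B ∪ row x) := by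
    intro x x' h
    by_contra hne
    refine (hsep _ _ (hBrow x) (hBrow x') h).not_ge (hrow x ▸ mk_le_mk_of_subset ?_)
    rintro _ ⟨t, rfl⟩
    refine ⟨Or.inr ⟨t, rfl⟩, ?_⟩
    rintro (⟨t', ht⟩ | ⟨t', ht⟩)
    · simp at ht
    · simp only [e.apply_eq_iff_eq, Sum.inr.injEq, Prod.mk.injEq, w.apply_eq_iff_eq] at ht
      exact hne ht.2.1.symm
  let T (k : K) : Set M := {x | ∀ p, x = e (.inr p) → p.1 < k}
  have hBT (k) : B ⊆ T k := by
    rintro _ ⟨t, rfl⟩ p hp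
    simp at hp
  have hT (Y : Set M) (hY : #Y = #L) : ∃ k, Y ⊆ T k := by
    obtain ⟨k, hk⟩ := hbound ((fun x => (e.symm x).elim (fun _ => k₀) Prod.fst) '' Y)
      (mk_image_le.trans hY.le)
    refine ⟨k, fun x hx p hp => ?_⟩
    simpa [hp] using hk _ ⟨x, hx, rfl⟩
  have hj (q : M) : ∃ k, ∀ Y : Set M, #Y = #L → d Y = q → #L ≤ #(Y ∩ T k : Set M) := by
    by_cases hq : ∃ Y : Set M, #Y = #L ∧ d Y = q
    · obtain ⟨Y, hY, rfl⟩ := hq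
      obtain ⟨k, hk⟩ := hT Y hY
      exact ⟨k, fun Z hZ h => (hinter Y Y Z hY subset_rfl hY hZ h.symm).trans
        (mk_le_mk_of_subset (Set.inter_subset_inter_right _ hk))⟩
    · exact ⟨k₀, fun Y hY h => absurd ⟨Y, hY, h⟩ hq⟩
  choose κ hκ using hj
  obtain ⟨f, hf, hR⟩ := Function.Embedding.schroeder_bernstein_of_rel
    (f := fun x => d (B ∪ row x)) (g := fun q => e (.inr (κ q, q))) hι
    (fun q q' h => by simpa using (show _ ∧ _ by simpa using h).2)
    (fun x q => (∀ p, x = e (.inr p) → ∀ Y : Set M, #Y = #L → d Y = q →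
        #L ≤ #(Y ∩ T p.1 : Set M)) ∧
      (x ∈ B → q = d (B ∪ row x)))
    (fun x => ⟨fun p _ Y hY h =>
      (hinter B _ Y hB Set.subset_union_left (hBrow x) hY h.symm).trans
        (mk_le_mk_of_subset (Set.inter_subset_inter_right _ (hBT _))), fun _ => rfl⟩)
    (fun q => ⟨fun p hp => by
      obtain rfl : (κ q, q) = p := by simpa using hp
      exact hκ q, fun ⟨t, ht⟩ => by simp at ht⟩)
  have hmeet (X : Set M)
      (hX : SelfCovering #L (fun Y => (Equiv.ofBijective f hf).symm (d Y)) X) :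
      #(B \ X : Set M) < #L := by
    have hne : {k | #L ≤ #(X ∩ T k : Set M)}.Nonempty := by
      obtain ⟨k, hk⟩ := hT X hX.1
      exact ⟨k, by simp [Set.inter_eq_left.2 hk, hX.1]⟩
    obtain ⟨k, hk, hmin⟩ := wellFounded_lt.has_min _ hne
    obtain ⟨x, hxX, hxk⟩ : (X ∩ T k).Nonempty := by
      rw [← Set.nonempty_coe_sort, ← mk_ne_zero_iff]
      exact (aleph0_pos.trans_le (hl.trans hk)).ne'
    obtain ⟨Y, hYX, hY, hYx⟩ := hX.2 x hxX
    have hYf : d Y = f x := ((Equiv.ofBijective f hf).symm_apply_eq).1 hYx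
    have hxB : x ∈ B := by
      obtain ⟨s, rfl⟩ := e.surjective x
      rcases s with t | p
      · exact ⟨t, rfl⟩
      · refine absurd (hxk p rfl) (hmin p.1 ?_)
        exact ((hR _).1 p rfl Y hY hYf).trans
          (mk_le_mk_of_subset (Set.inter_subset_inter_left _ hYX))
    refine (mk_le_mk_of_subset ?_).trans_lt
      (hsep (B ∪ row x) Y (hBrow x) hY (((hR x).2 hxB).symm.trans hYf.symm))
    exact Set.sdiff_subset_sdiff Set.subset_union_left hYX
  refine ⟨(Equiv.ofBijective f hf).symm, fun X X' hX hX' hdis => ?_⟩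
  rcases mk_eq_or_mk_eq_of_mk_union (A := B \ X) (B := B \ X') hl (by
    rw [← hB]; congr 2
    rw [← Set.sdiff_inter, hdis.inter_eq, Set.sdiff_empty]) with h | h
  · exact (hmeet X hX).ne h
  · exact (hmeet X' hX').ne h

open Cardinal in
theorem map_eq_of_bicard_of_infinite {M : Type u} {d : Set M → M}
    (hd : ∀ (π : M ≃ M) (X Y : Set M), d X = d Y → d (π '' X) = d (π '' Y))
    (hcat : ∀ σ₁ σ₂ : M ≃ M, ∃ Γ : M ≃ M, ∀ X, Γ (σ₁ (d X)) = σ₂ (d (Γ '' X))) {V W : Set M}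
    (hVW : Bicard V W) (hle : #V ≤ #(Vᶜ : Set M)) (hV : V.Infinite) : d V = d W := by
  have hl : ℵ₀ ≤ #V := Cardinal.infinite_iff.1 hV.to_subtype
  by_contra hne
  rcases hle.eq_or_lt with h | h
  · exact hne (map_eq_of_mk_eq_mk_compl hd hl rfl h.symm hVW.1.symm (hVW.2.symm.trans h.symm))
  have hM : #M = #(Vᶜ : Set M) := by rw [← mk_sum_compl V, add_eq_right (hl.trans hle) hle]
  have hlM : #V < #M := hM ▸ h
  have : Infinite M := Cardinal.infinite_iff.2 (hl.trans hlM.le)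
  have hcompl (A : Set M) (hA : #A ≤ #V) : #(Aᶜ : Set M) = #(Vᶜ : Set M) :=
    (mk_compl_of_infinite A (hA.trans_lt hlM)).trans hM
  have hsep (Y Z : Set M) (hY : #Y = #V) (hZ : #Z = #V) (h : d Y = d Z) : #(Y \ Z : Set M) < #V :=
    mk_diff_lt_of_map_eq hd hl hle rfl rfl hVW.1.symm hVW.2.symm hne hY (hcompl Y hY.le) h
      (hcompl _ ((mk_union_le Y Z).trans (add_le_of_le hl hY.le hZ.le)))
  obtain ⟨σ₁, X, X', hdis, hX, hX'⟩ := exists_perm_disjoint_selfCovering hl hlM hsep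
  obtain ⟨σ₂, hσ₂⟩ := exists_perm_not_disjoint_selfCovering hl hlM hsep
  obtain ⟨Γ, hΓ⟩ := hcat σ₁ σ₂
  exact hσ₂ _ _ (hX.image hΓ) (hX'.image hΓ) ((Set.disjoint_image_iff Γ.injective).2 hdis)

theorem Bicard.finite {M : Type*} {X Y : Set M} (h : Bicard X Y) (hX : X.Finite) : Y.Finite := by
  rw [← Set.finite_coe_iff, ← Cardinal.lt_aleph0_iff_finite] at hX ⊢
  exact h.1 ▸ hX

theorem Bicard.ncard_eq {M : Type*} {X Y : Set M} (h : Bicard X Y) : X.ncard = Y.ncard :=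
  congrArg Cardinal.toNat h.1

open Cardinal in
theorem Bicard.of_ncard_eq {M : Type*} {X Y : Set M} (hX : X.Finite) (hY : Y.Finite)
    (h : X.ncard = Y.ncard) : Bicard X Y := by
  have hXY : #X = #Y := toNat_injOn (lt_aleph0_iff_finite.2 hX) (lt_aleph0_iff_finite.2 hY) h
  refine ⟨hXY, ?_⟩
  rcases finite_or_infinite M with hM | hM
  · exact mk_compl_eq_mk_compl_finite_same hXY
  · exact mk_compl_eq_mk_compl_infinite
      ((lt_aleph0_iff_finite.2 hX).trans_le (aleph0_le_mk M))
      ((lt_aleph0_iff_finite.2 hY).trans_le (aleph0_le_mk M))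

theorem swap_image_eq_insert_diff {M : Type*} [DecidableEq M] {a b : M} {Y : Set M} (ha : a ∈ Y)
    (hb : b ∉ Y) : Equiv.swap a b '' Y = insert b (Y \ {a}) := by
  ext x
  simp only [Set.mem_image_equiv, Equiv.symm_swap, Equiv.swap_apply_def]
  grind

theorem swap_image_eq_self {M : Type*} [DecidableEq M] {a b : M} {Y : Set M} (h : a ∈ Y ↔ b ∈ Y) :
    Equiv.swap a b '' Y = Y := by
  ext x
  simp only [Set.mem_image_equiv, Equiv.symm_swap, Equiv.swap_apply_def]
  grind

open Cardinal in
theorem map_eq_map_insert_diff_of_bicard {M : Type u} {β : Type*} {d : Set M → β}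
    (hd : ∀ (π : M ≃ M) (X Y : Set M), d X = d Y → d (π '' X) = d (π '' Y))
    {Y U : Set M} {a b a' b' : M} (ha : a ∈ Y) (hb : b ∉ Y) (h : d Y = d (insert b (Y \ {a})))
    (hYU : Bicard Y U) (ha' : a' ∈ U) (hb' : b' ∉ U) : d U = d (insert b' (U \ {a'})) := by
  have hcells {Y : Set M} {a b : M} (ha : a ∈ Y) (hb : b ∉ Y) :
      #Y = #(Y \ {a} : Set M) + 1 ∧ #(Yᶜ : Set M) = #((insert b Y)ᶜ : Set M) + 1 ∧
      Y ∩ insert b (Y \ {a}) = Y \ {a} ∧ Y \ insert b (Y \ {a}) = {a} ∧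
      insert b (Y \ {a}) \ Y = {b} ∧ Y ∪ insert b (Y \ {a}) = insert b Y := by
    refine ⟨?_, ?_, ?_, ?_, ?_, ?_⟩
    · rw [← mk_insert (a := a) (by simp)]; congr 2; clear * - ha; grind
    · rw [← mk_insert (a := b) (by simp)]; congr 2; clear * - hb; grind
    all_goals clear * - ha hb; grind
  obtain ⟨h₁, h₂, h₃, h₄, h₅, h₆⟩ := hcells ha hb
  obtain ⟨h₁', h₂', h₃', h₄', h₅', h₆'⟩ := hcells ha' hb'
  obtain ⟨π, hπ, hπ'⟩ := exists_perm_image_eq_image_eq (U := Y) (U' := insert b (Y \ {a})) (V := U)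
    (V' := insert b' (U \ {a'}))
    (by rw [h₃, h₃', ← add_one_inj, ← h₁, ← h₁', hYU.1]) (by simp [h₄, h₄'])
    (by simp [h₅, h₅']) (by rw [h₆, h₆', ← add_one_inj, ← h₂, ← h₂', hYU.2])
  rw [← hπ', ← hπ]
  exact hd π _ _ h

theorem map_eq_of_forall_map_eq_map_insert_diff {M : Type u} {β : Type*} {d : Set M → β} (n : ℕ)
    (h : ∀ (U : Set M) (a b : M), U.Finite → U.ncard = n → a ∈ U → b ∉ U →
      d U = d (insert b (U \ {a})))
    {V W : Set M} (hV : V.Finite) (hW : W.Finite) (hVn : V.ncard = n) (hWn : W.ncard = n) :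
    d V = d W := by
  induction hk : (V \ W).ncard generalizing V with
  | zero =>
    rw [Set.ncard_eq_zero (hV.subset Set.sdiff_subset), Set.sdiff_eq_empty] at hk
    rw [Set.eq_of_subset_of_ncard_le hk (by lia) hW]
  | succ k ih =>
    obtain ⟨a, ha, haW⟩ := (Set.ncard_pos (s := V \ W) (hV.subset Set.sdiff_subset)).1 (by lia)
    obtain ⟨b, hb, hbV⟩ : (W \ V).Nonempty := by
      by_contra! hWV
      rw [Set.sdiff_eq_empty] at hWV
      exact haW (Set.eq_of_subset_of_ncard_le hWV (by lia) hV ▸ ha)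
    rw [h V a b hV hVn ha hbV]
    refine ih ((hV.subset Set.sdiff_subset).insert _) ?_ ?_
    · rw [Set.ncard_insert_of_notMem (by simp [hbV]) (hV.subset Set.sdiff_subset),
        Set.ncard_sdiff_singleton_add_one ha hV, hVn]
    · have : insert b (V \ {a}) \ W = (V \ W) \ {a} := by clear * - hb; grind
      rw [this, Set.ncard_sdiff_singleton_of_mem (show a ∈ V \ W from ⟨ha, haW⟩), hk,
        Nat.add_sub_cancel]

/-- An invariant map identifying two finite sets of the same size that are distinct and not
complementary identifies all sets of this size. -/
theorem map_eq_of_map_eq_of_finite {M : Type u} {β : Type*} {d : Set M → β}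
    (hd : ∀ (π : M ≃ M) (X Y : Set M), d X = d Y → d (π '' X) = d (π '' Y))
    {n : ℕ} {Y Z : Set M} (hY : Y.Finite) (hZ : Z.Finite) (hYn : Y.ncard = n) (hZn : Z.ncard = n)
    (h : d Y = d Z) (hne : Y ≠ Z) (hne' : Y ≠ Zᶜ) {V W : Set M} (hV : V.Finite) (hW : W.Finite)
    (hVn : V.ncard = n) (hWn : W.ncard = n) : d V = d W := by
  classical
  obtain ⟨y, hyY, hyZ⟩ : (Y \ Z).Nonempty := by
    by_contra! hYZ
    rw [Set.sdiff_eq_empty] at hYZ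
    exact hne (Set.eq_of_subset_of_ncard_le hYZ (by lia) hZ)
  obtain ⟨z, hzZ, hzY⟩ : (Z \ Y).Nonempty := by
    by_contra! hZY
    rw [Set.sdiff_eq_empty] at hZY
    exact hne (Set.eq_of_subset_of_ncard_le hZY (by lia) hY).symm
  obtain ⟨a, b, ha, hb, hab⟩ : ∃ a b, a ∈ Y ∧ b ∉ Y ∧ d Y = d (insert b (Y \ {a})) := by
    by_cases hout : ∃ b, b ∉ Y ∧ b ∉ Z
    · obtain ⟨b, hbY, hbZ⟩ := hout
      refine ⟨y, b, hyY, hbY, ?_⟩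
      have := hd (Equiv.swap y b) _ _ h
      rw [swap_image_eq_insert_diff hyY hbY, swap_image_eq_self (by simp [hyZ, hbZ])] at this
      rw [h, this]
    · obtain ⟨a, haY, haZ⟩ : (Y ∩ Z).Nonempty := by
        by_contra! hYZ
        refine hne' (Set.ext fun x => ?_)
        have : x ∉ Y ∩ Z := by simp [hYZ]
        clear * - hout this
        grind
      refine ⟨a, z, haY, hzY, ?_⟩
      have := hd (Equiv.swap a z) _ _ h
      rw [swap_image_eq_insert_diff haY hzY, swap_image_eq_self (by simp [haZ, hzZ])] at this
      rw [h, this]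
  exact map_eq_of_forall_map_eq_map_insert_diff n (fun U a' b' hU hUn ha' hb' =>
    map_eq_map_insert_diff_of_bicard hd ha hb hab (.of_ncard_eq hY hU (by lia)) ha' hb')
    hV hW hVn hWn

/-- For finite sets in an infinite type: otherwise `d` could be permuted both to have and to avoid
a value lying in its argument. -/
theorem map_eq_of_bicard_of_finite {M : Type u} [Infinite M] {d : Set M → M}
    (hd : ∀ (π : M ≃ M) (X Y : Set M), d X = d Y → d (π '' X) = d (π '' Y))
    (hcat : ∀ σ₁ σ₂ : M ≃ M, ∃ Γ : M ≃ M, ∀ X, Γ (σ₁ (d X)) = σ₂ (d (Γ '' X))) {V W : Set M}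
    (hVW : Bicard V W) (hV : V.Finite) : d V = d W := by
  classical
  by_contra hne
  obtain ⟨n, hn⟩ : ∃ n, V.ncard = n := ⟨_, rfl⟩
  have hinj {Y Z : Set M} (hY : Y.Finite) (hYn : Y.ncard = n) (hZ : Z.Finite) (hZn : Z.ncard = n)
      (h : d Y = d Z) : Y = Z := by
    by_contra hYZ
    exact hne (map_eq_of_map_eq_of_finite hd hY hZ hYn hZn h hYZ
      (fun h => hZ.infinite_compl (h ▸ hY)) hV (hVW.finite hV) hn (hVW.ncard_eq.symm.trans hn))
  obtain ⟨v, hv⟩ : V.Nonempty := by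
    by_contra! hV'
    have := hVW.ncard_eq
    rw [hV', Set.ncard_empty, eq_comm, Set.ncard_eq_zero (hVW.finite hV)] at this
    exact hne (by rw [hV', this])
  have hn0 : 0 < n := hn ▸ (Set.ncard_pos hV).2 ⟨v, hv⟩
  obtain ⟨w⟩ : Nonempty (M × ℕ ↪ M) := by
    rw [← Cardinal.lift_mk_le']
    simp
  have hs (x : M) : ∃ s, ∀ t, w (x, s + t) ≠ x := by
    by_cases hx : ∃ s, w (x, s) = x
    · obtain ⟨s, hs⟩ := hx
      refine ⟨s + 1, fun t ht => ?_⟩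
      simpa [add_assoc] using congrArg Prod.snd (w.injective (ht.trans hs.symm))
    · push Not at hx
      exact ⟨0, fun t => hx _⟩
  choose s hs using hs
  let y (x : M) : Set M := (fun t => w (x, s x + t)) '' Finset.range n
  have hy (x) : (y x).Finite := (Finset.finite_toSet _).image _
  have hyn (x) : (y x).ncard = n := by
    rw [Set.ncard_image_of_injective _ fun t t' h => by simpa using h, Set.ncard_coe_finset,
      Finset.card_range]
  have hm (q : M) : ∃ m, ∀ Y : Set M, Y.Finite → Y.ncard = n → d Y = q → w (q, m) ∉ Y := by
    by_cases hq : ∃ Y : Set M, Y.Finite ∧ Y.ncard = n ∧ d Y = q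
    · obtain ⟨Y, hY, hYn, hYq⟩ := hq
      obtain ⟨_, ⟨m, rfl⟩, hm⟩ := (Set.infinite_range_of_injective
        (f := fun m => w (q, m)) fun t t' h => by simpa using h).exists_notMem_finite hY
      exact ⟨m, fun Z hZ hZn h => hinj hZ hZn hY hYn (h.trans hYq.symm) ▸ hm⟩
    · exact ⟨0, fun Y hY hYn h => absurd ⟨Y, hY, hYn, h⟩ hq⟩
  choose m hm using hm
  obtain ⟨f, hf, hR⟩ := Function.Embedding.schroeder_bernstein_of_rel
    (f := fun x => d (y x)) (g := fun q => w (q, m q))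
    (fun x x' h => by
      have : w (x, s x + 0) ∈ y x' :=
        hinj (hy x) (hyn x) (hy x') (hyn x') h ▸ ⟨0, by simpa using hn0, rfl⟩
      obtain ⟨t, -, ht⟩ := this
      exact (congrArg Prod.fst (w.injective ht)).symm)
    (fun q q' h => congrArg Prod.fst (w.injective h))
    (fun x q => ∀ Y : Set M, Y.Finite → Y.ncard = n → d Y = q → x ∉ Y)
    (fun x Y hY hYn h => by
      rw [hinj hY hYn (hy x) (hyn x) h]
      rintro ⟨t, -, ht⟩
      exact hs x t ht)
    (fun q => hm q)
  obtain ⟨Γ, hΓ⟩ := hcat (Equiv.swap (d V) v) (Equiv.ofBijective f hf).symm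
  have hΓV := hΓ V
  rw [Equiv.swap_apply_left] at hΓV
  refine hR (Γ v) (Γ '' V) (hV.image _) ((Set.ncard_image_of_injective _ Γ.injective).trans hn) ?_
    ⟨v, hv, rfl⟩
  rw [hΓV]
  exact ((Equiv.ofBijective f hf).apply_symm_apply _).symm

theorem le_choose_of_pos_of_lt {N n : ℕ} (hn : 0 < n) (hnN : n < N) : N ≤ N.choose n := by
  induction N generalizing n with
  | zero => lia
  | succ k ih =>
    obtain ⟨m, rfl⟩ := Nat.exists_eq_succ_of_ne_zero hn.ne'
    rw [Nat.choose_succ_succ]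
    have h₁ := Nat.choose_pos (n := k) (k := m + 1) (by lia)
    rcases m.eq_zero_or_pos with rfl | hm
    · simp
    · have h₂ := ih hm (by lia)
      lia

theorem four_mul_le_centralBinom {n : ℕ} (hn : 3 ≤ n) : 4 * n ≤ n.centralBinom := by
  induction n, hn using Nat.le_induction with
  | base => decide
  | succ n hn ih =>
    have h := Nat.succ_mul_centralBinom_succ n
    have : 2 * n.centralBinom ≤ (n + 1).centralBinom := by
      refine le_of_mul_le_mul_left (a := n + 1) ?_ n.succ_pos
      rw [h]
      nlinarith
    lia

/-- In four points, `d` cannot separate the pairs up to complements. -/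
theorem false_of_card_eq_four {M : Type u} [Fintype M] (hM : Fintype.card M = 4)
    {d : Set M → M}
    (hcat : ∀ σ₁ σ₂ : M ≃ M, ∃ Γ : M ≃ M, ∀ X, Γ (σ₁ (d X)) = σ₂ (d (Γ '' X)))
    (hempty : ∀ Y : Set M, Y.ncard = 2 → d Y ≠ d ∅)
    (hfib : ∀ Y Z : Set M, Y.ncard = 2 → Z.ncard = 2 → d Y = d Z → Y = Z ∨ Y = Zᶜ) : False := by
  classical
  have hex (S : Finset M) (hS : S.card < 4) : ∃ x, x ∉ S := by
    by_contra! h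
    rw [← Finset.eq_univ_iff_forall] at h
    rw [h, Finset.card_univ, hM] at hS
    exact hS.false
  obtain ⟨p, -⟩ := hex ∅ (by simp)
  obtain ⟨a, ha⟩ := hex {p} (by simp)
  obtain ⟨b, hb⟩ := hex {p, a} (Finset.card_le_two.trans_lt (by lia))
  simp only [Finset.mem_singleton, Finset.mem_insert, not_or] at ha hb
  let τ (x : M) : M := if x = p then d ∅ else d {p, x}
  have hp : τ p = d ∅ := if_pos rfl
  have hτ {x : M} (hx : x ≠ p) : τ x = d {p, x} := if_neg hx
  have hpair {x : M} (hx : x ≠ p) : ({p, x} : Set M).ncard = 2 := Set.ncard_pair hx.symm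
  have hinj : Function.Injective τ := by
    intro x x' h
    by_cases hx : x = p <;> by_cases hx' : x' = p
    · rw [hx, hx']
    · rw [hx, hp, hτ hx'] at h
      exact absurd h.symm (hempty _ (hpair hx'))
    · rw [hx', hp, hτ hx] at h
      exact absurd h (hempty _ (hpair hx))
    · rw [hτ hx, hτ hx'] at h
      have h' := hfib _ _ (hpair hx) (hpair hx') h
      clear * - h' hx hx'
      rcases h' with h' | h' <;> rw [Set.ext_iff] at h'
      · have := h' x
        simp_all
      · have := h' p
        simp at this
  let σ := (Equiv.ofBijective τ (Finite.injective_iff_bijective.1 hinj)).symm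
  have hσ (q : M) : σ (τ q) = q := Equiv.ofBijective_symm_apply_apply τ _ q
  have hmem (Y : Set M) (hY : Y.ncard = 2) : σ (d Y) ∈ Y ↔ σ (d ∅) ∈ Y := by
    obtain ⟨q, hq⟩ := (Finite.injective_iff_bijective.1 hinj).2 (d Y)
    have hqp : q ≠ p := by
      rintro rfl
      exact hempty Y hY (hq.symm.trans hp)
    rw [← hq, ← hp, hσ, hσ]
    rw [hτ hqp] at hq
    rcases hfib _ _ hY (hpair hqp) hq.symm with rfl | rfl <;> simp
  obtain ⟨Γ, hΓ⟩ := hcat σ (σ.trans (Equiv.swap a b))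
  have himg : Γ '' (Γ.symm '' {p, a}) = {p, a} := Γ.image_symm_image _
  have hpre (x : M) : x ∈ Γ.symm '' {p, a} ↔ Γ x ∈ ({p, a} : Set M) := by
    simp only [Set.mem_image_equiv, Equiv.symm_symm]
  have h₁ := hΓ (Γ.symm '' {p, a})
  have h₂ := hΓ ∅
  rw [himg, ← hτ ha, Equiv.trans_apply, hσ, Equiv.swap_apply_left] at h₁
  rw [Set.image_empty, ← hp, Equiv.trans_apply, hσ,
    Equiv.swap_apply_of_ne_of_ne (Ne.symm ha) (Ne.symm hb.1)] at h₂
  have := hmem (Γ.symm '' {p, a})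
    ((Set.ncard_image_of_injective _ Γ.symm.injective).trans (hpair ha))
  rw [hpre, hpre, h₁, ← hp, hσ, h₂] at this
  simp [hb] at this

/-- For finite types the claim follows by counting, up to one exceptional case in four points. -/
theorem map_eq_of_bicard_of_finite_type {M : Type u} [Finite M] {d : Set M → M}
    (hd : ∀ (π : M ≃ M) (X Y : Set M), d X = d Y → d (π '' X) = d (π '' Y))
    (hcat : ∀ σ₁ σ₂ : M ≃ M, ∃ Γ : M ≃ M, ∀ X, Γ (σ₁ (d X)) = σ₂ (d (Γ '' X))) {V W : Set M}
    (hVW : Bicard V W) (hle : V.ncard ≤ Vᶜ.ncard) : d V = d W := by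
  classical
  have := Fintype.ofFinite M
  by_contra hne
  obtain ⟨n, hn⟩ : ∃ n, V.ncard = n := ⟨_, rfl⟩
  have hWn : W.ncard = n := hVW.ncard_eq.symm.trans hn
  have hnN : 2 * n ≤ Fintype.card M := by
    have := Set.ncard_add_ncard_compl V
    rw [Nat.card_eq_fintype_card] at this
    lia
  have hn0 : 0 < n := by
    by_contra! h0
    rw [Nat.le_zero.1 h0, Set.ncard_eq_zero] at hn hWn
    exact hne (by rw [hn, hWn])
  have hfib (Y Z : Set M) (hY : Y.ncard = n) (hZ : Z.ncard = n) (h : d Y = d Z) :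
      Y = Z ∨ Y = Zᶜ := by
    by_contra! hYZ
    exact hne (map_eq_of_map_eq_of_finite hd Y.toFinite Z.toFinite hY hZ h hYZ.1 hYZ.2
      V.toFinite W.toFinite hn hWn)
  have hempty (Y : Set M) (hY : Y.ncard = n) : d Y ≠ d ∅ := by
    intro h
    have hconst (A : Set M) (hA : A.ncard = n) : d A = d ∅ := by
      obtain ⟨π, rfl⟩ := exists_perm_image_eq_of_bicard
        (Bicard.of_ncard_eq Y.toFinite A.toFinite (hY.trans hA.symm))
      simpa using hd π _ _ h
    exact hne ((hconst V hn).trans (hconst W hWn).symm)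
  have hcard {c : ℕ} (hc : ∀ Y : Set M, Y.ncard = n → ∀ S : Finset (Finset M),
      (∀ Z ∈ S, Z.card = n ∧ d Z = d Y) → S.card ≤ c) :
      (Fintype.card M).choose n ≤ c * (Fintype.card M - 1) := by
    rw [← Finset.card_univ, ← Finset.card_powersetCard, ← Finset.card_erase_of_mem
      (Finset.mem_univ (d ∅))]
    refine Finset.card_le_mul_card_image_of_maps_to (f := fun Z : Finset M => d Z)
      (fun Z hZ => ?_) c (fun q _ => ?_)
    · simp only [Finset.mem_erase, Finset.mem_univ, and_true]
      exact hempty _ (by simpa using hZ)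
    · rcases Finset.eq_empty_or_nonempty ((Finset.powersetCard n Finset.univ).filter
        fun Z : Finset M => d Z = q) with h | ⟨Y, hY⟩
      · simp [h]
      · simp only [Finset.mem_filter, Finset.mem_powersetCard_univ] at hY
        refine hc Y (by simpa using hY.1) _ fun Z hZ => ?_
        simp only [Finset.mem_filter, Finset.mem_powersetCard_univ] at hZ
        exact ⟨hZ.1, hZ.2.trans hY.2.symm⟩
  rcases hnN.lt_or_eq with hlt | heq
  · have := hcard (c := 1) fun Y hY S hS => Finset.card_le_one.2 fun A hA B hB => by
      rcases hfib A B (by simpa using (hS A hA).1) (by simpa using (hS B hB).1)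
        ((hS A hA).2.trans (hS B hB).2.symm) with h | h
      · exact_mod_cast h
      · have h' := congrArg Set.ncard h
        rw [← Finset.coe_compl, Set.ncard_coe_finset, Set.ncard_coe_finset, Finset.card_compl,
          (hS A hA).1, (hS B hB).1] at h'
        lia
    have := le_choose_of_pos_of_lt hn0 (show n < Fintype.card M by lia)
    lia
  · have hchoose := hcard (c := 2) fun Y hY S hS => by
      refine (Finset.card_le_card (t := {Y.toFinset, Y.toFinsetᶜ}) fun Z hZ => ?_).trans
        Finset.card_le_two
      rcases hfib Z Y (by simpa using (hS Z hZ).1) hY (hS Z hZ).2 with h | h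
      · simp [← h]
      · simp [← Finset.coe_inj, h]
    rw [← heq, ← Nat.centralBinom_eq_two_mul_choose] at hchoose
    have h2 : 2 ≤ n := by
      by_contra! h1
      have hlt : ({d ∅, d V, d W} : Finset M).card ≤ 2 := by
        refine (Finset.card_le_univ _).trans ?_
        lia
      rw [Finset.card_eq_three.2 ⟨_, _, _, (hempty V hn).symm, (hempty W hWn).symm, hne, rfl⟩]
        at hlt
      lia
    rcases h2.eq_or_lt with rfl | h3
    · exact false_of_card_eq_four heq.symm hcat hempty hfib
    · have := four_mul_le_centralBinom h3
      lia

open Cardinal in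
theorem map_eq_of_bicard_of_mk_le {M : Type u} {d : Set M → M}
    (hd : ∀ (π : M ≃ M) (X Y : Set M), d X = d Y → d (π '' X) = d (π '' Y))
    (hcat : ∀ σ₁ σ₂ : M ≃ M, ∃ Γ : M ≃ M, ∀ X, Γ (σ₁ (d X)) = σ₂ (d (Γ '' X))) {V W : Set M}
    (hVW : Bicard V W) (hle : #V ≤ #(Vᶜ : Set M)) : d V = d W := by
  rcases V.finite_or_infinite with hV | hV
  · rcases finite_or_infinite M with hM | hM
    · exact map_eq_of_bicard_of_finite_type hd hcat hVW
        (toNat_le_toNat hle (lt_aleph0_iff_finite.2 Vᶜ.toFinite))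
    · exact map_eq_of_bicard_of_finite hd hcat hVW hV
  · exact map_eq_of_bicard_of_infinite hd hcat hVW hle hV

open Cardinal in
theorem map_eq_of_bicard {M : Type u} {d : Set M → M}
    (hd : ∀ (π : M ≃ M) (X Y : Set M), d X = d Y → d (π '' X) = d (π '' Y))
    (hcat : ∀ σ₁ σ₂ : M ≃ M, ∃ Γ : M ≃ M, ∀ X, Γ (σ₁ (d X)) = σ₂ (d (Γ '' X))) {V W : Set M}
    (hVW : Bicard V W) : d V = d W := by
  rcases le_total #V #(Vᶜ : Set M) with h | h
  · exact map_eq_of_bicard_of_mk_le hd hcat hVW h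
  · have := map_eq_of_bicard_of_mk_le (d := fun X => d Xᶜ) (V := Vᶜ) (W := Wᶜ)
      (fun π X Y hXY => by
        simpa only [Set.image_compl_eq π.bijective] using hd π _ _ hXY)
      (fun σ₁ σ₂ => by
        obtain ⟨Γ, hΓ⟩ := hcat σ₁ σ₂
        exact ⟨Γ, fun X => by rw [hΓ, Set.image_compl_eq Γ.bijective]⟩)
      ⟨hVW.2, by simpa using hVW.1⟩ (by simpa using h)
    simpa using this

/-- Surjective relative categoricity theorem. -/
theorem surjective_relative_categoricity
    (E : ∀ M : Type u, Set M → Set M → Prop)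
    (hEq : ∀ M : Type u, Equivalence (E M))
    (hInv : ∀ (M N : Type u) (e : M ≃ N) (X Y : Set M),
      E M X Y ↔ E N (e '' X) (e '' Y)) :
    ((∀ (M : Type u) (d₁ d₂ : Set M → M),
        (∀ X Y : Set M, d₁ X = d₁ Y ↔ E M X Y) →
        (∀ X Y : Set M, d₂ X = d₂ Y ↔ E M X Y) →
        Function.Surjective d₁ → Function.Surjective d₂ →
        ∃ Γ : M ≃ M, ∀ X : Set M, Γ (d₁ X) = d₂ (Γ '' X))
      ↔
      (∀ (M : Type u) (d : Set M → M),
        (∀ X Y : Set M, d X = d Y ↔ E M X Y) →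
        Function.Surjective d →
        ∀ X Y : Set M, Bicard X Y → E M X Y)) := by
  refine ⟨fun hcat M d hdE hs X Y hXY => ?_, fun hbic M d₁ d₂ h₁ h₂ hs₁ hs₂ => ?_⟩
  · refine (hdE X Y).1 (map_eq_of_bicard (fun π X Y h => ?_) (fun σ₁ σ₂ => ?_) hXY)
    · exact (hdE _ _).2 ((hInv M M π X Y).1 ((hdE X Y).1 h))
    · exact hcat M (fun X => σ₁ (d X)) (fun X => σ₂ (d X))
        (fun X Y => σ₁.apply_eq_iff_eq.trans (hdE X Y))
        (fun X Y => σ₂.apply_eq_iff_eq.trans (hdE X Y))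
        (σ₁.surjective.comp hs) (σ₂.surjective.comp hs)
  · have hker (X Y : Set M) : d₁ X = d₁ Y ↔ d₂ X = d₂ Y := (h₁ X Y).trans (h₂ X Y).symm
    choose s₁ hs₁ using hs₁
    have hs (X : Set M) : d₂ (s₁ (d₁ X)) = d₂ X := (hker _ _).1 (hs₁ _)
    have hbij : Function.Bijective fun a => d₂ (s₁ a) := by
      refine ⟨fun a b h => ?_, fun c => ?_⟩
      · rw [← hs₁ a, ← hs₁ b, hker]
        exact h
      · obtain ⟨X, rfl⟩ := hs₂ c
        exact ⟨d₁ X, hs X⟩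
    refine ⟨Equiv.ofBijective _ hbij, fun X => (hs X).trans ?_⟩
    refine (h₂ _ _).2 (hbic M d₂ h₂ hs₂ _ _ ⟨(Cardinal.mk_image_eq hbij.1).symm, ?_⟩)
    rw [← Set.image_compl_eq (Equiv.bijective _), Cardinal.mk_image_eq (Equiv.injective _)]
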